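/- Let a > 0, β > 0, c ∈ (0,1) and n ≥ 1 with a < cβ. Let x_{1,n}^C < ... < x_{n,n}^C denote the roots of the Charlier polynomial C_n(x;a) and x_{1,n}^M < ... < x_{n,n}^M denote the roots of the Meixner polynomial M_n(x;β,c). Then x_{j,n}^C < x_{j,n}^M for every j = 1,...,n. -/

import Mathlib

open Polynomial Filter

noncomputable def deltaOp (h : ℝ) (f : ℝ → ℝ) (x : ℝ) : ℝ := f (x + h) - f x

noncomputable def nablaOp (h : ℝ) (f : ℝ → ℝ) (x : ℝ) : ℝ := f x - f (x - h)

noncomputable def forceF (h x y : ℝ) : ℝ := 1 / (2 * h) * Real.log ((y - x + h) / (y - x - h))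

noncomputable def potV (h x y : ℝ) : ℝ :=
  (x - y) / (2 * h) * Real.log ((y - x + h) / (y - x - h))
    - 1 / 2 * Real.log ((y - x + h) * (y - x - h))

noncomputable def extForce (h : ℝ) (A B : Polynomial ℝ) (x : ℝ) : ℝ :=
  1 / (2 * h) * Real.log (1 + B.eval x / A.eval x)

noncomputable def energy (h : ℝ) (φ : ℝ → ℝ) {n : ℕ} (x : Fin n → ℝ) : ℝ :=
  (∑ j, ∑ k ∈ Finset.univ.erase j, potV h (x k) (x j)) + 2 * ∑ j, φ (x j)

def GapGt (h : ℝ) {n : ℕ} (x : Fin n → ℝ) : Prop :=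
  ∀ i : ℕ, ∀ hi : i + 1 < n, x ⟨i + 1, hi⟩ - x ⟨i, Nat.lt_of_succ_lt hi⟩ > h

def SatisfiesDiffEq (h : ℝ) (A B C p : Polynomial ℝ) : Prop :=
  ∀ x : ℝ,
    A.eval x * deltaOp h (nablaOp h fun t => p.eval t) x
      + B.eval x * deltaOp h (fun t => p.eval t) x + C.eval x * p.eval x = 0

def InIoo (a b : EReal) (y : ℝ) : Prop := a < (y : EReal) ∧ (y : EReal) < b

def IsCriticalDist (h : ℝ) (A B : Polynomial ℝ) (a b : EReal) {n : ℕ}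
    (x : Fin n → ℝ) : Prop :=
  StrictMono x ∧ (∀ j, InIoo a b (x j)) ∧ GapGt h x ∧
    ∀ j, (∑ k ∈ Finset.univ.erase j, forceF h (x k) (x j)) + extForce h A B (x j) = 0

def Admissible (h : ℝ) (a b : EReal) {n : ℕ} (x : Fin n → ℝ) : Prop :=
  StrictMono x ∧ (∀ j, a ≤ (x j : EReal) ∧ (x j : EReal) ≤ b) ∧ GapGt h x

def IsEquilibrium (h : ℝ) (φ : ℝ → ℝ) (a b : EReal) {n : ℕ} (x : Fin n → ℝ) : Prop :=
  Admissible h a b x ∧ ∀ y : Fin n → ℝ, Admissible h a b y → energy h φ x ≤ energy h φ y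

noncomputable def ratFn (A B : Polynomial ℝ) (x : ℝ) : ℝ := 1 + B.eval x / A.eval x

def GConvexOn (A B : Polynomial ℝ) (a b : EReal) : Prop :=
  a < b ∧
  (∀ x : ℝ, InIoo a b x → 0 < ratFn A B x) ∧
  (∀ x y : ℝ, InIoo a b x → InIoo a b y → x < y → ratFn A B y < ratFn A B x) ∧
  (∀ a' : ℝ, a = (a' : EReal) → A.eval a' = 0) ∧
  (a = ⊥ → (Tendsto (ratFn A B) atBot atTop ∨
      ∃ L : ℝ, 1 < L ∧ Tendsto (ratFn A B) atBot (nhds L))) ∧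
  (∀ b' : ℝ, b = (b' : EReal) → (A + B).eval b' = 0) ∧
  (b = ⊤ → ∃ L : ℝ, 0 ≤ L ∧ L < 1 ∧ Tendsto (ratFn A B) atTop (nhds L))

def IsPotential (h : ℝ) (A B : Polynomial ℝ) (a b : EReal) (φ : ℝ → ℝ) : Prop :=
  ∀ x : ℝ, InIoo a b x → HasDerivAt φ (-(extForce h A B x)) x

noncomputable def partialD {n : ℕ} (f : (Fin n → ℝ) → ℝ) (j : Fin n) (z : Fin n → ℝ) : ℝ :=
  deriv (fun t => f (Function.update z j t)) (z j)

noncomputable def poch (t : ℝ) (k : ℕ) : ℝ := (ascPochhammer ℝ k).eval t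

noncomputable def negXPoch (k : ℕ) : Polynomial ℝ := (ascPochhammer ℝ k).comp (-Polynomial.X)

noncomputable def charlier (n : ℕ) (a : ℝ) : Polynomial ℝ :=
  ∑ k ∈ Finset.range (n + 1),
    Polynomial.C (poch (-(n : ℝ)) k / (k.factorial : ℝ) * (-1 / a) ^ k) * negXPoch k

noncomputable def krawtchouk (n : ℕ) (p : ℝ) (N : ℕ) : Polynomial ℝ :=
  ∑ k ∈ Finset.range (n + 1),
    Polynomial.C (poch (-(n : ℝ)) k / ((k.factorial : ℝ) * poch (-(N : ℝ)) k) * (1 / p) ^ k) *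
      negXPoch k

noncomputable def meixner (n : ℕ) (β c : ℝ) : Polynomial ℝ :=
  ∑ k ∈ Finset.range (n + 1),
    Polynomial.C (poch (-(n : ℝ)) k / ((k.factorial : ℝ) * poch β k) * (1 - 1 / c) ^ k) *
      negXPoch k

noncomputable def hahn (n : ℕ) (α β : ℝ) (N : ℕ) : Polynomial ℝ :=
  ∑ k ∈ Finset.range (n + 1),
    Polynomial.C (poch (-(n : ℝ)) k * poch ((n : ℝ) + α + β + 1) k /
        ((k.factorial : ℝ) * poch (α + 1) k * poch (-(N : ℝ)) k)) * negXPoch k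

def IsRootTuple {n : ℕ} (p : Polynomial ℝ) (x : Fin n → ℝ) : Prop :=
  StrictMono x ∧ ∀ y : ℝ, p.IsRoot y ↔ ∃ j, y = x j

theorem mul_eval_negXPoch_sub_one (k : ℕ) (x : ℝ) :
    x * (negXPoch k).eval (x - 1) = -(negXPoch (k + 1)).eval x := by
  simp only [negXPoch, eval_comp, eval_neg, eval_X, ascPochhammer_succ_left, eval_mul, eval_add,
    eval_one]
  rw [show -(x - 1) = -x + 1 by ring]
  ring

theorem eval_negXPoch_succ (k : ℕ) (x : ℝ) :
    (negXPoch (k + 1)).eval x = (negXPoch k).eval x * (k - x) := by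
  simp only [negXPoch, eval_comp, eval_neg, eval_X, ascPochhammer_succ_right, eval_mul, eval_add,
    eval_natCast]
  ring

theorem eval_negXPoch_succ_add_one (k : ℕ) (x : ℝ) :
    (negXPoch (k + 1)).eval (x + 1) - (negXPoch (k + 1)).eval x
      = -((k : ℝ) + 1) * (negXPoch k).eval x := by
  have h := mul_eval_negXPoch_sub_one k (x + 1)
  rw [add_sub_cancel_right] at h
  linear_combination h - eval_negXPoch_succ k x

/-- The polynomial `∑ₖ (n choose k) fₖ (-x)_k`. -/
noncomputable def chooseSum (n : ℕ) (f : ℕ → ℝ) : Polynomial ℝ :=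
  ∑ k ∈ Finset.range (n + 1), Polynomial.C ((n.choose k : ℝ) * f k) * negXPoch k

theorem eval_chooseSum (n : ℕ) (f : ℕ → ℝ) (x : ℝ) :
    (chooseSum n f).eval x
      = ∑ k ∈ Finset.range (n + 1), (n.choose k : ℝ) * (f k * (negXPoch k).eval x) := by
  simp only [chooseSum, eval_finsetSum, eval_mul, eval_C, mul_assoc]

theorem poch_neg_natCast_div_factorial (n k : ℕ) :
    poch (-(n : ℝ)) k / (k.factorial : ℝ) = (-1) ^ k * (n.choose k : ℝ) := by
  have hk : (k.factorial : ℝ) ≠ 0 := by positivity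
  rw [poch, ascPochhammer_eval_neg_eq_descPochhammer, descPochhammer_eval_eq_descFactorial,
    Nat.descFactorial_eq_factorial_mul_choose]
  push_cast
  field_simp

theorem poch_pos {t : ℝ} (ht : 0 < t) (k : ℕ) : 0 < poch t k := ascPochhammer_pos k t ht

theorem poch_succ_left (t : ℝ) (k : ℕ) : poch t (k + 1) = t * poch (t + 1) k := by
  simp [poch, ascPochhammer_succ_left]

theorem poch_succ_right (t : ℝ) (k : ℕ) : poch t (k + 1) = poch t k * (t + k) := by
  simp [poch, ascPochhammer_succ_right]

theorem charlier_eq_chooseSum (n : ℕ) (a : ℝ) :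
    charlier n a = chooseSum n fun k => (1 / a) ^ k := by
  refine Finset.sum_congr rfl fun k _ => ?_
  rw [poch_neg_natCast_div_factorial, neg_div, neg_pow (1 / a)]
  congr 2
  linear_combination (n.choose k : ℝ) * (1 / a) ^ k * (Even.neg_one_pow (Even.add_self k) :
    (-1 : ℝ) ^ (k + k) = 1)

theorem meixner_eq_chooseSum (n : ℕ) (β c : ℝ) :
    meixner n β c = chooseSum n fun k => (1 / c - 1) ^ k / poch β k := by
  refine Finset.sum_congr rfl fun k _ => ?_
  rw [← div_div, poch_neg_natCast_div_factorial, show 1 - 1 / c = -(1 / c - 1) by ring,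
    neg_pow (1 / c - 1)]
  congr 2
  linear_combination (n.choose k : ℝ) * (1 / c - 1) ^ k / poch β k *
    (Even.neg_one_pow (Even.add_self k) : (-1 : ℝ) ^ (k + k) = 1)

theorem sum_choose_succ_mul (n : ℕ) (F : ℕ → ℝ) :
    ∑ k ∈ Finset.range (n + 2), ((n + 1).choose k : ℝ) * F k
      = ∑ k ∈ Finset.range (n + 1), (n.choose k : ℝ) * (F k + F (k + 1)) := by
  have h : ∑ k ∈ Finset.range (n + 1), (n.choose k : ℝ) * F k
      = ∑ k ∈ Finset.range (n + 1), (n.choose (k + 1) : ℝ) * F (k + 1) + F 0 := by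
    have h1 := Finset.sum_range_succ (fun k => (n.choose k : ℝ) * F k) (n + 1)
    have h2 := Finset.sum_range_succ' (fun k => (n.choose k : ℝ) * F k) (n + 1)
    simp only [Nat.choose_succ_self, Nat.cast_zero, zero_mul, add_zero, Nat.choose_zero_right,
      Nat.cast_one, one_mul] at h1 h2
    rw [← h1, h2]
  rw [Finset.sum_range_succ']
  simp only [mul_add, Finset.sum_add_distrib, Nat.choose_succ_succ', Nat.cast_add, add_mul, h,
    Nat.choose_zero_right, Nat.cast_one, one_mul]
  ring

/-- The backward shift relation. -/
theorem eval_chooseSum_succ {f f' : ℕ → ℝ} {u₀ u₁ v : ℝ}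
    (h₁ : ∀ k, (u₀ + u₁ * k) * f' k = f k) (h₂ : ∀ k, (v - u₁) * f' k = f (k + 1))
    (n : ℕ) (x : ℝ) :
    (chooseSum (n + 1) f).eval x = (u₀ + u₁ * x) * (chooseSum n f').eval x
      - v * x * (chooseSum n f').eval (x - 1) := by
  simp only [eval_chooseSum, sum_choose_succ_mul, Finset.mul_sum, ← Finset.sum_sub_distrib]
  refine Finset.sum_congr rfl fun k _ => ?_
  linear_combination (-(n.choose k : ℝ) * (negXPoch k).eval x) * h₁ k
    - (n.choose k : ℝ) * (negXPoch (k + 1)).eval x * h₂ k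
    + (n.choose k : ℝ) * v * f' k * mul_eval_negXPoch_sub_one k x
    - (n.choose k : ℝ) * u₁ * f' k * eval_negXPoch_succ k x

/-- The forward shift relation. -/
theorem eval_chooseSum_add_one_sub {f f' : ℕ → ℝ} {w : ℝ} (h : ∀ k, w * f' k = f (k + 1))
    (n : ℕ) (x : ℝ) :
    (chooseSum (n + 1) f).eval (x + 1) - (chooseSum (n + 1) f).eval x
      = -((n : ℝ) + 1) * w * (chooseSum n f').eval x := by
  simp only [eval_chooseSum, ← Finset.sum_sub_distrib, Finset.mul_sum]
  rw [Finset.sum_range_succ']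
  have h0 : ∀ t : ℝ, (negXPoch 0).eval t = 1 := by simp [negXPoch]
  simp only [h0, sub_self, add_zero]
  refine Finset.sum_congr rfl fun k _ => ?_
  have hc : ((n : ℝ) + 1) * n.choose k = (n + 1).choose (k + 1) * ((k : ℝ) + 1) := by
    exact_mod_cast Nat.add_one_mul_choose_eq n k
  linear_combination ((n + 1).choose (k + 1) : ℝ) * f (k + 1) * eval_negXPoch_succ_add_one k x
    + (negXPoch k).eval x * w * f' k * hc
    + ((n + 1).choose (k + 1) : ℝ) * ((k : ℝ) + 1) * (negXPoch k).eval x * h k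

/-- The difference equation, at a root. -/
theorem chooseSum_eval_add_one_of_isRoot {f f' : ℕ → ℝ} {u₀ u₁ v : ℝ}
    (h₁ : ∀ k, (u₀ + u₁ * k) * f' k = f k) (h₂ : ∀ k, (v - u₁) * f' k = f (k + 1))
    (n : ℕ) {x : ℝ} (hx : (chooseSum (n + 1) f).eval x = 0) :
    (u₀ + u₁ * x) * (chooseSum (n + 1) f).eval (x + 1)
      + v * x * (chooseSum (n + 1) f).eval (x - 1) = 0 := by
  have hr := eval_chooseSum_succ h₁ h₂ n x
  have hl := eval_chooseSum_add_one_sub h₂ n x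
  have hl' := eval_chooseSum_add_one_sub h₂ n (x - 1)
  rw [sub_add_cancel] at hl'
  rw [hx] at hr hl hl'
  linear_combination (u₀ + u₁ * x) * hl - v * x * hl' + ((n : ℝ) + 1) * (v - u₁) * hr

theorem natDegree_prod_C_sub_X_le (m : ℕ) (y : ℕ → ℝ) :
    (∏ i ∈ Finset.range m, (C (y i) - X)).natDegree ≤ m := by
  refine (natDegree_prod_le _ _).trans ?_
  refine (Finset.sum_le_card_nsmul _ _ 1 fun i _ => ?_).trans (by simp)
  compute_degree

theorem coeff_prod_C_sub_X (m : ℕ) (y : ℕ → ℝ) :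
    (∏ i ∈ Finset.range m, (C (y i) - X)).coeff m = (-1) ^ m := by
  have h := coeff_prod_of_natDegree_le (s := Finset.range m) (fun i => C (y i) - X) 1
    (fun i _ => by compute_degree)
  simpa [coeff_C] using h

/-- `y 0, …, y (n - 1)` are positive, with consecutive gaps larger than one. -/
def IsSpaced (n : ℕ) (y : ℕ → ℝ) : Prop :=
  (∀ i < n, 0 < y i) ∧ ∀ i, i + 1 < n → y i + 1 < y (i + 1)

theorem IsSpaced.add_one_lt {n : ℕ} {y : ℕ → ℝ} (h : IsSpaced n y) {i j : ℕ} (hij : i < j)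
    (hj : j < n) : y i + 1 < y j := by
  induction j, hij using Nat.le_induction with
  | base => exact h.2 i hj
  | succ j hij ih => linarith [ih (by omega), h.2 j hj]

theorem neg_one_pow_mul_prod_pos {n i : ℕ} (hi : i ≤ n) {y : ℕ → ℝ} {x : ℝ}
    (hlt : ∀ j < i, y j < x) (hgt : ∀ j, i ≤ j → j < n → x < y j) :
    0 < (-1) ^ i * ∏ j ∈ Finset.range n, (y j - x) := by
  rw [← Finset.prod_range_mul_prod_Ico _ hi, ← mul_assoc]
  have h : (-1) ^ i * ∏ j ∈ Finset.range i, (y j - x) = ∏ j ∈ Finset.range i, (x - y j) := by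
    rw [← Finset.card_range i, ← Finset.prod_const, Finset.card_range, ← Finset.prod_mul_distrib]
    exact Finset.prod_congr rfl fun j _ => by ring
  rw [h]
  refine mul_pos (Finset.prod_pos fun j hj => ?_) (Finset.prod_pos fun j hj => ?_)
  · linarith [hlt j (Finset.mem_range.1 hj)]
  · have := Finset.mem_Ico.1 hj
    linarith [hgt j this.1 this.2]

/-- `p` is a polynomial of degree `n` with a spaced sequence of roots, positive at zero. -/
def HasSpacedRoots (n : ℕ) (p : Polynomial ℝ) : Prop :=
  ∃ K > 0, ∃ y, IsSpaced n y ∧ p = C K * ∏ i ∈ Finset.range n, (C (y i) - X)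

theorem HasSpacedRoots.backward_shift {n : ℕ} {p P : Polynomial ℝ} {u₀ u₁ v : ℝ}
    (hu₀ : 0 < u₀) (hu₁ : 0 ≤ u₁) (huv : u₁ < v) (hp : HasSpacedRoots n p)
    (hP : ∀ x, P.eval x = (u₀ + u₁ * x) * p.eval x - v * x * p.eval (x - 1)) :
    HasSpacedRoots (n + 1) P := by
  obtain ⟨K, hK, y, hy, rfl⟩ := hp
  have hPpoly : P = C K * (C u₀ * ∏ i ∈ Finset.range n, (C (y i) - X)
      + C u₁ * (X * ∏ i ∈ Finset.range n, (C (y i) - X))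
      - C v * (X * ∏ i ∈ Finset.range n, (C (y i + 1) - X))) := by
    refine Polynomial.funext fun x => ?_
    rw [hP]
    simp only [eval_mul, eval_C, eval_prod, eval_sub, eval_X, eval_add,
      show ∀ i, y i - (x - 1) = y i + 1 - x from fun i => by ring]
    ring
  have hdeg : P.natDegree ≤ n + 1 := by
    have h1 := natDegree_prod_C_sub_X_le n y
    have h2 := natDegree_prod_C_sub_X_le n fun i => y i + 1
    have hX : ∀ q : ℝ[X], q.natDegree ≤ n → (X * q).natDegree ≤ n + 1 := fun q hq =>
      natDegree_mul_le.trans (by rw [natDegree_X]; omega)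
    rw [hPpoly]
    refine (natDegree_C_mul_le _ _).trans ((natDegree_sub_le_iff_left ?_).2
      (natDegree_add_le_of_degree_le ?_ ?_))
    rotate_left
    · exact (natDegree_C_mul_le _ _).trans (h1.trans n.le_succ)
    · exact (natDegree_C_mul_le _ _).trans (hX _ h1)
    · exact (natDegree_C_mul_le _ _).trans (hX _ h2)
  have hcoeff : P.coeff (n + 1) = (v - u₁) * K * (-1) ^ (n + 1) := by
    have h := coeff_prod_C_sub_X n fun i => y i + 1
    rw [hPpoly]
    simp only [coeff_C_mul, coeff_sub, coeff_add, coeff_X_mul, coeff_prod_C_sub_X, h]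
    rw [coeff_eq_zero_of_natDegree_lt (Nat.lt_succ_of_le (natDegree_prod_C_sub_X_le n y))]
    ring
  have hL : 0 < (v - u₁) * K := mul_pos (sub_pos.2 huv) hK
  have hsign : ∀ i ≤ n, ∀ x, (∀ j < i, y j < x) → (∀ j, i ≤ j → j < n → x < y j) →
      0 < (-1) ^ i * (C K * ∏ i ∈ Finset.range n, (C (y i) - X)).eval x := by
    intro i hi x hlt hgt
    simp only [eval_mul, eval_C, eval_prod, eval_sub, eval_X]
    rw [mul_left_comm]
    exact mul_pos hK (neg_one_pow_mul_prod_pos hi hlt hgt)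
  have hroot : ∀ j < n, (C K * ∏ i ∈ Finset.range n, (C (y i) - X)).eval (y j) = 0 := by
    intro j hj
    simp only [eval_mul, eval_C, eval_prod, eval_sub, eval_X]
    rw [Finset.prod_eq_zero (Finset.mem_range.2 hj) (sub_self _), mul_zero]
  set p : ℝ[X] := C K * ∏ i ∈ Finset.range n, (C (y i) - X) with hp
  have hleft : ∃ l : ℕ → ℝ, l 0 = 0 ∧ ∀ i, l (i + 1) = y i + 1 :=
    ⟨fun i => Nat.casesOn i 0 fun i => y i + 1, rfl, fun _ => rfl⟩
  obtain ⟨l, hl0, hl⟩ := hleft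
  have hl_nonneg : ∀ i ≤ n, 0 ≤ l i := by
    rintro (_ | i) hi
    · exact hl0.ge
    · rw [hl]; linarith [hy.1 i hi]
  have hPl : ∀ i ≤ n, 0 < (-1) ^ i * P.eval (l i) := by
    intro i hi
    have hs : 0 < (-1) ^ i * p.eval (l i) := by
      refine hsign i hi _ (fun j hj => ?_) (fun j hij hj => ?_)
      · obtain _ | i := i
        · omega
        · rw [hl]
          rcases Nat.lt_succ_iff_lt_or_eq.1 hj with h | rfl
          · linarith [hy.add_one_lt h hi]
          · linarith
      · obtain _ | i := i
        · rw [hl0]; exact hy.1 j hj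
        · rw [hl]; exact hy.add_one_lt hij hj
    have hz : l i * p.eval (l i - 1) = 0 := by
      obtain _ | i := i
      · rw [hl0, zero_mul]
      · rw [hl, add_sub_cancel_right, hroot i hi, mul_zero]
    have hu : 0 < u₀ + u₁ * l i := by
      have := mul_nonneg hu₁ (hl_nonneg i hi)
      linarith
    have : (-1) ^ i * P.eval (l i) = (u₀ + u₁ * l i) * ((-1) ^ i * p.eval (l i)) := by
      rw [hP]; linear_combination -(-1) ^ i * v * hz
    rw [this]
    exact mul_pos hu hs
  have hright : ∀ i ≤ n, ∃ r, l i < r ∧ (i < n → r = y i) ∧ (-1) ^ i * P.eval r < 0 := by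
    intro i hi
    rcases hi.lt_or_eq with hi | rfl
    · refine ⟨y i, ?_, fun _ => rfl, ?_⟩
      · obtain _ | i := i
        · rw [hl0]; exact hy.1 0 hi
        · rw [hl]; exact hy.2 i hi
      · have hs : 0 < (-1) ^ i * p.eval (y i - 1) := by
          refine hsign i hi.le _ (fun j hj => ?_) (fun j hij hj => ?_)
          · linarith [hy.add_one_lt hj hi]
          · rcases hij.lt_or_eq with h | rfl
            · linarith [hy.add_one_lt h hj]
            · linarith
        have hv : 0 < v * y i := mul_pos (hu₁.trans_lt huv) (hy.1 i hi)
        rw [hP, hroot i hi]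
        nlinarith [mul_pos hv hs]
    · have hc : (C ((-1) ^ (i + 1)) * P).coeff (i + 1) = (v - u₁) * K := by
        rw [coeff_C_mul, hcoeff]
        linear_combination (v - u₁) * K * (Even.neg_one_pow (Even.add_self (i + 1)) :
          (-1 : ℝ) ^ (i + 1 + (i + 1)) = 1)
      have hd : (C ((-1) ^ (i + 1)) * P).natDegree = i + 1 :=
        natDegree_eq_of_le_of_coeff_ne_zero ((natDegree_C_mul_le _ _).trans hdeg)
          (hc ▸ hL.ne')
      have ht := tendsto_atTop_of_leadingCoeff_nonneg (C ((-1) ^ (i + 1)) * P)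
        (natDegree_pos_iff_degree_pos.1 (by omega)) (by rw [leadingCoeff, hd, hc]; exact hL.le)
      obtain ⟨r, hr, hlr⟩ := ((ht.eventually_gt_atTop 0).and (eventually_gt_atTop (l i))).exists
      refine ⟨r, hlr, fun h => absurd h (lt_irrefl _), ?_⟩
      rw [eval_mul, eval_C, pow_succ] at hr
      linarith
  have hz : ∀ i, ∃ z, i ≤ n → l i < z ∧ (i < n → z < y i) ∧ P.eval z = 0 := by
    intro i
    by_cases hi : i ≤ n
    swap
    · exact ⟨0, fun h => absurd h hi⟩
    obtain ⟨r, hlr, hry, hr⟩ := hright i hi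
    have hcont : ContinuousOn (fun x => (-1) ^ i * P.eval x) (Set.Icc (l i) r) := by fun_prop
    obtain ⟨z, hz, hz0⟩ := intermediate_value_Ioo' hlr.le hcont ⟨hr, hPl i hi⟩
    refine ⟨z, fun _ => ⟨hz.1, fun h => hry h ▸ hz.2, ?_⟩⟩
    exact (mul_eq_zero.1 hz0).resolve_left (pow_ne_zero _ (by norm_num))
  choose z hz using hz
  have hzs : IsSpaced (n + 1) z := by
    refine ⟨fun i hi => ?_, fun i hi => ?_⟩
    · exact (hl_nonneg i (by omega)).trans_lt (hz i (by omega)).1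
    · have h1 := (hz i (by omega)).2.1 (by omega)
      have h2 := (hz (i + 1) (by omega)).1
      rw [hl] at h2
      linarith
  refine ⟨(v - u₁) * K, hL, z, hzs, sub_eq_zero.1 ?_⟩
  have hinj : Set.InjOn z (Finset.range (n + 1)) := by
    intro i hi j hj hij
    simp only [Finset.coe_range, Set.mem_Iio] at hi hj
    rcases lt_trichotomy i j with h | h | h
    · linarith [hzs.add_one_lt h hj]
    · exact h
    · linarith [hzs.add_one_lt h hi]
  refine eq_zero_of_degree_lt_of_eval_finset_eq_zero ((Finset.range (n + 1)).image z) ?_ ?_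
  · rw [Finset.card_image_of_injOn hinj, Finset.card_range, degree_lt_iff_coeff_zero]
    intro m hm
    rcases hm.lt_or_eq with h | rfl
    · exact coeff_eq_zero_of_natDegree_lt (((natDegree_sub_le_iff_left
        ((natDegree_C_mul_le _ _).trans (natDegree_prod_C_sub_X_le _ z))).2 hdeg).trans_lt h)
    · rw [coeff_sub, coeff_C_mul, coeff_prod_C_sub_X, hcoeff, sub_self]
  · intro x hx
    obtain ⟨i, hi, rfl⟩ := Finset.mem_image.1 hx
    simp only [eval_sub, eval_mul, eval_C, eval_prod, eval_X]
    rw [(hz i (Nat.lt_succ_iff.1 (Finset.mem_range.1 hi))).2.2,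
      Finset.prod_eq_zero hi (sub_self _), mul_zero, sub_zero]

theorem hasSpacedRoots_chooseSum_zero {f : ℕ → ℝ} (hf : 0 < f 0) :
    HasSpacedRoots 0 (chooseSum 0 f) :=
  ⟨f 0, hf, fun _ => 0, ⟨by simp, by simp⟩, by simp [chooseSum, negXPoch]⟩

theorem inv_pow_shift (a : ℝ) (k : ℕ) :
    (1 + 0 * (k : ℝ)) * (1 / a) ^ k = (1 / a) ^ k ∧
      (1 / a - 0) * (1 / a) ^ k = (1 / a) ^ (k + 1) :=
  ⟨by ring, by ring⟩

theorem pow_div_poch_shift {β c : ℝ} (hβ : 0 < β) (hc : c ≠ 0) (k : ℕ) :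
    (1 + 1 / β * (k : ℝ)) * ((1 / c - 1) ^ k / poch (β + 1) k) = (1 / c - 1) ^ k / poch β k ∧
      (1 / (c * β) - 1 / β) * ((1 / c - 1) ^ k / poch (β + 1) k)
        = (1 / c - 1) ^ (k + 1) / poch β (k + 1) := by
  have h0 := (poch_pos hβ k).ne'
  have h1 := (poch_pos (add_pos hβ one_pos) k).ne'
  have h := (poch_succ_left β k).symm.trans (poch_succ_right β k)
  rw [pow_succ, poch_succ_left]
  generalize (1 / c - 1) ^ k = g
  constructor
  · field_simp
    linear_combination -g * h
  · field_simp

theorem hasSpacedRoots_charlier {a : ℝ} (ha : 0 < a) (n : ℕ) :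
    HasSpacedRoots n (charlier n a) := by
  rw [charlier_eq_chooseSum]
  induction n with
  | zero => exact hasSpacedRoots_chooseSum_zero (by simp)
  | succ n ih =>
    exact ih.backward_shift one_pos le_rfl (one_div_pos.2 ha) (eval_chooseSum_succ
      (fun k => (inv_pow_shift a k).1) (fun k => (inv_pow_shift a k).2) n)

theorem hasSpacedRoots_meixner {β c : ℝ} (hβ : 0 < β) (hc : 0 < c) (hc1 : c < 1) (n : ℕ) :
    HasSpacedRoots n (meixner n β c) := by
  rw [meixner_eq_chooseSum]
  induction n generalizing β with
  | zero => exact hasSpacedRoots_chooseSum_zero (by simp [poch])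
  | succ n ih =>
    refine (ih (add_pos hβ one_pos)).backward_shift one_pos (one_div_pos.2 hβ).le ?_
      (eval_chooseSum_succ (fun k => (pow_div_poch_shift hβ hc.ne' k).1)
        (fun k => (pow_div_poch_shift hβ hc.ne' k).2) n)
    exact one_div_lt_one_div_of_lt (mul_pos hc hβ) (mul_lt_of_lt_one_left hβ hc1)

theorem charlier_eval_add_one_of_isRoot {a : ℝ} (ha : 0 < a) (n : ℕ) {x : ℝ}
    (hx : (charlier (n + 1) a).eval x = 0) :
    a * (charlier (n + 1) a).eval (x + 1) + x * (charlier (n + 1) a).eval (x - 1) = 0 := by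
  rw [charlier_eq_chooseSum] at hx ⊢
  have h := chooseSum_eval_add_one_of_isRoot
    (fun k => (inv_pow_shift a k).1) (fun k => (inv_pow_shift a k).2) n hx
  field_simp at h
  linear_combination h

theorem meixner_eval_add_one_of_isRoot {β c : ℝ} (hβ : 0 < β) (hc : 0 < c) (n : ℕ) {x : ℝ}
    (hx : (meixner (n + 1) β c).eval x = 0) :
    c * (x + β) * (meixner (n + 1) β c).eval (x + 1)
      + x * (meixner (n + 1) β c).eval (x - 1) = 0 := by
  rw [meixner_eq_chooseSum] at hx ⊢
  have h := chooseSum_eval_add_one_of_isRoot (fun k => (pow_div_poch_shift hβ hc.ne' k).1)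
    (fun k => (pow_div_poch_shift hβ hc.ne' k).2) n hx
  generalize (fun k : ℕ => (1 / c - 1) ^ k / poch β k) = f at h ⊢
  field_simp at h
  linear_combination h

/-- The equilibrium equations for the roots, in multiplicative form. -/
theorem IsSpaced.prod_ratio_eq {n : ℕ} {y : ℕ → ℝ} (hy : IsSpaced n y) {K : ℝ} (hK : K ≠ 0)
    {j : ℕ} (hj : j < n) {w : ℝ}
    (h : w * (C K * ∏ i ∈ Finset.range n, (C (y i) - X)).eval (y j + 1)
      + y j * (C K * ∏ i ∈ Finset.range n, (C (y i) - X)).eval (y j - 1) = 0) :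
    ∏ k ∈ (Finset.range n).erase j, (y k - y j + 1) / (y k - y j - 1) = w / y j := by
  simp only [eval_mul, eval_C, eval_prod, eval_sub, eval_X] at h
  rw [← Finset.mul_prod_erase _ _ (Finset.mem_range.2 hj),
    ← Finset.mul_prod_erase _ (fun i => y i - (y j - 1)) (Finset.mem_range.2 hj)] at h
  simp only [show ∀ i, y i - (y j + 1) = y i - y j - 1 from fun i => by ring,
    show ∀ i, y i - (y j - 1) = y i - y j + 1 from fun i => by ring] at h
  have hne : ∏ k ∈ (Finset.range n).erase j, (y k - y j - 1) ≠ 0 := by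
    refine Finset.prod_ne_zero_iff.2 fun k hk => ?_
    obtain ⟨hkj, hk⟩ := Finset.mem_erase.1 hk
    rcases lt_or_gt_of_ne hkj with h | h
    · linarith [hy.add_one_lt h hj]
    · linarith [hy.add_one_lt h (Finset.mem_range.1 hk)]
  rw [Finset.prod_div_distrib, div_eq_div_iff hne (hy.1 j hj).ne']
  refine mul_left_cancel₀ hK ?_
  linear_combination h

theorem ratio_le_ratio_of_le {s t : ℝ} (hst : s ≤ t) (h : t < -1 ∨ 1 < s) :
    (t + 1) / (t - 1) ≤ (s + 1) / (s - 1) := by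
  rcases h with h | h
  · rw [← neg_div_neg_eq, ← neg_div_neg_eq (s + 1), div_le_div_iff₀ (by linarith) (by linarith)]
    linarith
  · rw [div_le_div_iff₀ (by linarith) (by linarith)]
    linarith

theorem ratio_pos {t : ℝ} (h : t < -1 ∨ 1 < t) : 0 < (t + 1) / (t - 1) := by
  rcases h with h | h
  · exact div_pos_of_neg_of_neg (by linarith) (by linarith)
  · exact div_pos (by linarith) (by linarith)

/-- Comparison of two equilibrium configurations under a comparison of the external forces. -/
theorem IsSpaced.lt_of_prod_ratio_eq {n : ℕ} {x y : ℕ → ℝ} (hx : IsSpaced n x)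
    (hy : IsSpaced n y) {F G : ℝ → ℝ} (hFG : ∀ s t, 0 < t → t ≤ s → F s < G t)
    (hF : ∀ j < n, ∏ k ∈ (Finset.range n).erase j, (x k - x j + 1) / (x k - x j - 1) = F (x j))
    (hG : ∀ j < n, ∏ k ∈ (Finset.range n).erase j, (y k - y j + 1) / (y k - y j - 1) = G (y j))
    {i : ℕ} (hi : i < n) : x i < y i := by
  by_contra! hle
  obtain ⟨j, hj, hmax⟩ := Finset.exists_max_image (Finset.range n) (fun k => x k - y k)
    ⟨i, Finset.mem_range.2 hi⟩
  have hji := hmax i (Finset.mem_range.2 hi)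
  rw [Finset.mem_range] at hj
  refine absurd (hFG (x j) (y j) (hy.1 j hj) (by linarith)) (not_lt.2 ?_)
  rw [← hF j hj, ← hG j hj]
  refine Finset.prod_le_prod (fun k hk => ?_) fun k hk => ?_ <;>
    obtain ⟨hkj, hk⟩ := Finset.mem_erase.1 hk
  · refine (ratio_pos ?_).le
    rcases lt_or_gt_of_ne hkj with h | h
    · exact Or.inl (by linarith [hy.add_one_lt h hj])
    · exact Or.inr (by linarith [hy.add_one_lt h (Finset.mem_range.1 hk)])
  · refine ratio_le_ratio_of_le (by linarith [hmax k hk]) ?_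
    rcases lt_or_gt_of_ne hkj with h | h
    · exact Or.inl (by linarith [hy.add_one_lt h hj])
    · exact Or.inr (by linarith [hx.add_one_lt h (Finset.mem_range.1 hk)])

theorem eval_C_mul_prod_eq_zero_iff {n : ℕ} {y : ℕ → ℝ} {K : ℝ} (hK : K ≠ 0) (t : ℝ) :
    (C K * ∏ i ∈ Finset.range n, (C (y i) - X)).eval t = 0 ↔ ∃ i < n, t = y i := by
  simp [eval_prod, Finset.prod_eq_zero_iff, hK, sub_eq_zero, eq_comm (a := t)]

theorem IsRootTuple.eq_of_isSpaced {n : ℕ} {y : ℕ → ℝ} {K : ℝ} (hK : K ≠ 0)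
    (hy : IsSpaced n y) {x : Fin n → ℝ}
    (hx : IsRootTuple (C K * ∏ i ∈ Finset.range n, (C (y i) - X)) x) (j : Fin n) :
    x j = y j := by
  have hmono : StrictMono fun j : Fin n => y j := fun i j hij => by
    linarith [hy.add_one_lt hij j.2]
  refine congrFun ((StrictMono.range_inj hx.1 hmono).1 ?_) j
  ext t
  have h := (hx.2 t).symm.trans (eval_C_mul_prod_eq_zero_iff hK t)
  simp only [Set.mem_range, eq_comm (b := t)]
  rw [h]
  exact ⟨fun ⟨i, hi, ht⟩ => ⟨⟨i, hi⟩, ht⟩, fun ⟨i, ht⟩ => ⟨i, i.2, ht⟩⟩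

/-- if `a < cβ`, the roots of the Charlier polynomial `C_n(·;a)` are
componentwise smaller than the roots of the Meixner polynomial `M_n(·;β,c)`. -/
theorem charlier_roots_lt_meixner_roots
    (a β c : ℝ) (ha : 0 < a) (hβ : 0 < β) (hc : 0 < c) (hc1 : c < 1)
    (n : ℕ) (hn : 1 ≤ n) (hcond : a < c * β)
    (xC xM : Fin n → ℝ)
    (hC : IsRootTuple (charlier n a) xC) (hM : IsRootTuple (meixner n β c) xM) :
    ∀ j, xC j < xM j := by
  obtain ⟨m, rfl⟩ := Nat.exists_eq_add_of_le' hn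
  have hdC := fun x => charlier_eval_add_one_of_isRoot ha m (x := x)
  have hdM := fun x => meixner_eval_add_one_of_isRoot hβ hc m (x := x)
  obtain ⟨K, hK, y, hy, hyC⟩ := hasSpacedRoots_charlier ha (m + 1)
  obtain ⟨L, hL, z, hz, hzM⟩ := hasSpacedRoots_meixner hβ hc hc1 (m + 1)
  rw [hyC] at hC hdC
  rw [hzM] at hM hdM
  intro j
  rw [hC.eq_of_isSpaced hK.ne' hy, hM.eq_of_isSpaced hL.ne' hz]
  refine hy.lt_of_prod_ratio_eq hz (F := fun s => a / s) (G := fun t => c * (t + β) / t)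
    (fun s t ht hts => ?_) (fun i hi => ?_) (fun i hi => ?_) j.2
  · refine (div_le_div_of_nonneg_left ha.le ht hts).trans_lt (div_lt_div_of_pos_right ?_ ht)
    linarith [mul_pos hc ht]
  · exact hy.prod_ratio_eq hK.ne' hi
      (hdC _ ((eval_C_mul_prod_eq_zero_iff hK.ne' _).2 ⟨i, hi, rfl⟩))
  · exact hz.prod_ratio_eq hL.ne' hi
      (hdM _ ((eval_C_mul_prod_eq_zero_iff hL.ne' _).2 ⟨i, hi, rfl⟩))
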